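/- arXiv:1503.07650 — 5 statements merged into one kernel-verified Lean document; each statement's English description precedes it below -/
import Mathlib

section
/- Let K be the (p=∞, σ=1) Mumford–Michor kernel on ℝ² with K(0) := (1/2)·I. For r > 0 and φ, p_r, p_φ ∈ ℝ, set ρ = r²/2, q̃ = (r cos φ, r sin φ) and p̃ = (p_r cos φ − (p_φ/r) sin φ, p_r sin φ + (p_φ/r) cos φ). Then the reduced Hamiltonian in polar coordinates is p̃ ⬝ (K(0) − K(q̃)) p̃ = (p_r²/2)·(1 − (1−e^{−ρ})/ρ) + (p_φ²/(4ρ))·(1 − 2e^{−ρ} + (1−e^{−ρ})/ρ). -/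
open Matrix Real

/-- The `(p = ∞, σ = 1)` Mumford–Michor kernel on `ℝ²`: for `x ≠ 0`, with `ρ = ‖x‖²/2`,
`K(x) = (e^{-ρ} - (1-e^{-ρ})/(2ρ))·I + ((1-e^{-ρ})/ρ - e^{-ρ})·(x xᵀ/‖x‖²)`,
and `K(0) := (1/2)·I`. -/
noncomputable def MMkernel (x : Fin 2 → ℝ) : Matrix (Fin 2) (Fin 2) ℝ :=
  if x = 0 then (1 / 2 : ℝ) • (1 : Matrix (Fin 2) (Fin 2) ℝ)
  else
    (Real.exp (-((x 0 ^ 2 + x 1 ^ 2) / 2)) -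
        (1 - Real.exp (-((x 0 ^ 2 + x 1 ^ 2) / 2))) / (2 * ((x 0 ^ 2 + x 1 ^ 2) / 2))) •
      (1 : Matrix (Fin 2) (Fin 2) ℝ) +
    ((1 - Real.exp (-((x 0 ^ 2 + x 1 ^ 2) / 2))) / ((x 0 ^ 2 + x 1 ^ 2) / 2) -
        Real.exp (-((x 0 ^ 2 + x 1 ^ 2) / 2))) •
      Matrix.of (fun i j => x i * x j / (x 0 ^ 2 + x 1 ^ 2))

/-- The quadratic form of `K(0) - K(x)` depends only on `‖x‖²`, `‖u‖²` and `⟨x, u⟩`. -/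
theorem dotProduct_MMkernel_zero_sub_mulVec {x : Fin 2 → ℝ} (hx : x ≠ 0) (u : Fin 2 → ℝ)
    {s : ℝ} (hs : x 0 ^ 2 + x 1 ^ 2 = s) :
    u ⬝ᵥ (MMkernel 0 - MMkernel x).mulVec u =
      (1 / 2 - (Real.exp (-(s / 2)) - (1 - Real.exp (-(s / 2))) / (2 * (s / 2)))) *
          (u 0 ^ 2 + u 1 ^ 2) -
        ((1 - Real.exp (-(s / 2))) / (s / 2) - Real.exp (-(s / 2))) *
          ((x 0 * u 0 + x 1 * u 1) ^ 2 / s) := by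
  simp only [MMkernel, if_true, if_neg hx, hs, dotProduct, mulVec, Fin.sum_univ_two,
    Matrix.sub_apply, Matrix.add_apply, Matrix.smul_apply, Matrix.of_apply, smul_eq_mul,
    Matrix.one_apply_eq, Matrix.one_apply_ne zero_ne_one, Matrix.one_apply_ne one_ne_zero]
  ring

/-- The reduced two-`0`-jetlet Hamiltonian in polar coordinates:
`p̃ ⬝ (K(0) - K(q̃)) p̃ = (p_r²/2)(1 - (1-e^{-ρ})/ρ) + (p_φ²/(4ρ))(1 - 2e^{-ρ} + (1-e^{-ρ})/ρ)`
where `ρ = r²/2`, `q̃ = (r cos φ, r sin φ)` and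
`p̃ = (p_r cos φ - (p_φ/r) sin φ, p_r sin φ + (p_φ/r) cos φ)`. -/
theorem reduced_hamiltonian_polar (r φ p_r p_φ : ℝ) (hr : 0 < r) :
    (![p_r * Real.cos φ - (p_φ / r) * Real.sin φ,
        p_r * Real.sin φ + (p_φ / r) * Real.cos φ]) ⬝ᵥ
      (MMkernel 0 - MMkernel ![r * Real.cos φ, r * Real.sin φ]).mulVec
        (![p_r * Real.cos φ - (p_φ / r) * Real.sin φ,
            p_r * Real.sin φ + (p_φ / r) * Real.cos φ]) =
      p_r ^ 2 / 2 * (1 - (1 - Real.exp (-(r ^ 2 / 2))) / (r ^ 2 / 2)) +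
        p_φ ^ 2 / (4 * (r ^ 2 / 2)) *
          (1 - 2 * Real.exp (-(r ^ 2 / 2)) +
            (1 - Real.exp (-(r ^ 2 / 2))) / (r ^ 2 / 2)) := by
  have hcs := Real.sin_sq_add_cos_sq φ
  have hs : (![r * Real.cos φ, r * Real.sin φ] : Fin 2 → ℝ) 0 ^ 2 +
      (![r * Real.cos φ, r * Real.sin φ] : Fin 2 → ℝ) 1 ^ 2 = r ^ 2 := by
    simp only [cons_val_zero, cons_val_one]
    linear_combination r ^ 2 * hcs
  have hx : (![r * Real.cos φ, r * Real.sin φ] : Fin 2 → ℝ) ≠ 0 := by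
    intro h
    rw [h] at hs
    simp [hr.ne', eq_comm] at hs
  have hnorm : (p_r * Real.cos φ - p_φ / r * Real.sin φ) ^ 2 +
      (p_r * Real.sin φ + p_φ / r * Real.cos φ) ^ 2 = p_r ^ 2 + (p_φ / r) ^ 2 := by
    linear_combination (p_r ^ 2 + (p_φ / r) ^ 2) * hcs
  have hinner : r * Real.cos φ * (p_r * Real.cos φ - p_φ / r * Real.sin φ) +
      r * Real.sin φ * (p_r * Real.sin φ + p_φ / r * Real.cos φ) = r * p_r := by
    linear_combination r * p_r * hcs
  rw [dotProduct_MMkernel_zero_sub_mulVec hx _ hs]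
  simp only [cons_val_zero, cons_val_one, hnorm, hinner]
  field_simp
  ring
end

section
/- Fix p_r, p_φ ∈ ℝ. Then, as ρ → 0 with ρ ≠ 0, the reduced Hamiltonian H(ρ) = (p_r²/2)·(1 − (1−e^{−ρ})/ρ) + (p_φ²/(4ρ))·(1 − 2e^{−ρ} + (1−e^{−ρ})/ρ) satisfies H(ρ) − [ (p_r²/4)·ρ + (p_φ²/8)·(3 − (5/3)ρ) ] = O(ρ²). -/
open Filter Asymptotics

/-- The third-order Taylor polynomial of `exp (-x)` at `0`, with fourth-order remainder. -/
theorem exp_neg_sub_cubic_isBigO :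
    (fun x : ℝ => Real.exp (-x) - (1 - x + x ^ 2 / 2 - x ^ 3 / 6)) =O[nhds 0]
      (fun x : ℝ => x ^ 4) := by
  have h := (Real.exp_sub_sum_range_isBigO_pow 4).comp_tendsto
    (continuous_neg.tendsto' (0 : ℝ) 0 neg_zero)
  refine h.congr (fun x => ?_) (fun x => ?_)
  · simp only [Function.comp_apply, Finset.sum_range_succ, Finset.sum_range_zero, Nat.factorial]
    push_cast
    ring
  · simp only [Function.comp_apply]
    ring

/-- Expansion of the reduced two-`0`-jetlet Hamiltonian around `ρ = 0`:
`H(ρ) = (p_r²/4)ρ + (p_φ²/8)(3 - (5/3)ρ) + O(ρ²)` as `ρ → 0`, `ρ ≠ 0`. -/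
theorem reduced_hamiltonian_expansion (p_r p_φ : ℝ) :
    (fun ρ : ℝ =>
        (p_r ^ 2 / 2 * (1 - (1 - Real.exp (-ρ)) / ρ) +
            p_φ ^ 2 / (4 * ρ) * (1 - 2 * Real.exp (-ρ) + (1 - Real.exp (-ρ)) / ρ)) -
          (p_r ^ 2 / 4 * ρ + p_φ ^ 2 / 8 * (3 - 5 / 3 * ρ)))
      =O[nhdsWithin 0 {(0 : ℝ)}ᶜ] (fun ρ : ℝ => ρ ^ 2) := by
  set R : ℝ → ℝ := fun x => Real.exp (-x) - (1 - x + x ^ 2 / 2 - x ^ 3 / 6) with hR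
  have hquot : (fun ρ : ℝ => R ρ * (ρ ^ 2)⁻¹) =O[nhdsWithin 0 {(0 : ℝ)}ᶜ]
      (fun ρ : ℝ => ρ ^ 2) := by
    refine ((exp_neg_sub_cubic_isBigO.mono nhdsWithin_le_nhds).mul
      (isBigO_refl (fun ρ : ℝ => (ρ ^ 2)⁻¹) _)).congr' .rfl ?_
    filter_upwards [self_mem_nhdsWithin] with ρ (hρ : ρ ≠ 0)
    field_simp
  have hcoef : (fun ρ : ℝ => p_r ^ 2 / 2 * ρ - p_φ ^ 2 / 2 * ρ - p_φ ^ 2 / 4)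
      =O[nhdsWithin 0 {(0 : ℝ)}ᶜ] (fun _ : ℝ => (1 : ℝ)) := by
    have hc : Continuous fun ρ : ℝ => p_r ^ 2 / 2 * ρ - p_φ ^ 2 / 2 * ρ - p_φ ^ 2 / 4 := by
      fun_prop
    exact ((hc.tendsto 0).isBigO_one ℝ).mono nhdsWithin_le_nhds
  have hprod := hcoef.mul hquot
  simp only [one_mul] at hprod
  refine (((isBigO_refl (fun ρ : ℝ => ρ ^ 2) _).const_mul_left
    (p_φ ^ 2 / 12 - p_r ^ 2 / 12)).add hprod).congr' ?_ .rfl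
  filter_upwards [self_mem_nhdsWithin] with ρ (hρ : ρ ≠ 0)
  simp only [hR]
  field_simp
  ring
end

section
/- Let ζ, p_φ ∈ ℝ, let M = [[ζ,0],[p_φ,0]], let R(θ) = [[cos θ, −sin θ],[sin θ, cos θ]], and define μ(t) = R((3/4)p_φ·t)·M·R((3/4)p_φ·t)ᵀ and ξ(t) = (3/4)μ(t) − (1/4)μ(t)ᵀ. Then for every t ∈ ℝ, μ is differentiable at t with μ′(t) = μ(t)·ξ(t)ᵀ − ξ(t)ᵀ·μ(t). That is, the asymptotic trajectory of two merging 0-jetlets (rotating with angular velocity (3/4)p_φ, with relative angular momentum p_φ and radial constant ζ) is an exact solution of the single 1-jetlet evolution equation μ̇ = [μ, ξᵀ], where ξ is the velocity gradient determined by μ through the second derivative of the Mumford–Michor kernel at the origin. -/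
open Matrix Real

attribute [local instance] Matrix.normedAddCommGroup Matrix.normedSpace

/-- The rotation matrix by angle `θ`. -/
noncomputable def Rot (θ : ℝ) : Matrix (Fin 2) (Fin 2) ℝ :=
  !![Real.cos θ, -Real.sin θ; Real.sin θ, Real.cos θ]

/-- The asymptotic trajectory of two merging `0`-jetlets, rotating with angular velocity
`(3/4)p_φ`, with relative angular momentum `p_φ` and radial constant `ζ`:
`μ(t) = R((3/4)p_φ t)·M·R((3/4)p_φ t)ᵀ` with `M = [[ζ,0],[p_φ,0]]`. -/
noncomputable def mergedState (ζ p_φ : ℝ) (t : ℝ) : Matrix (Fin 2) (Fin 2) ℝ :=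
  Rot (3 / 4 * p_φ * t) * !![ζ, 0; p_φ, 0] * (Rot (3 / 4 * p_φ * t))ᵀ

/-- The velocity gradient determined by a jetlet momentum `μ` through the second
derivative of the Mumford–Michor kernel at the origin: `ξ = (3/4)μ - (1/4)μᵀ`. -/
noncomputable def velGrad (μ : Matrix (Fin 2) (Fin 2) ℝ) : Matrix (Fin 2) (Fin 2) ℝ :=
  (3 / 4 : ℝ) • μ - (1 / 4 : ℝ) • μᵀ

theorem transpose_Rot_mul_Rot (θ : ℝ) : (Rot θ)ᵀ * Rot θ = 1 := by
  ext i j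
  fin_cases i <;> fin_cases j <;>
    simp [Rot, Matrix.mul_apply, ← pow_two, mul_comm]

/-- Only the symmetric part of the velocity gradient contributes to the evolution. -/
theorem commutator_velGrad (μ : Matrix (Fin 2) (Fin 2) ℝ) :
    μ * (velGrad μ)ᵀ - (velGrad μ)ᵀ * μ = (3 / 4 : ℝ) • (μ * μᵀ - μᵀ * μ) := by
  simp only [velGrad, transpose_sub, transpose_smul, transpose_transpose, mul_sub, sub_mul,
    mul_smul_comm, smul_mul_assoc, smul_sub]
  abel

theorem commutator_transpose_conj_Rot (θ : ℝ) (M : Matrix (Fin 2) (Fin 2) ℝ) :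
    (Rot θ * M * (Rot θ)ᵀ) * (Rot θ * M * (Rot θ)ᵀ)ᵀ -
        (Rot θ * M * (Rot θ)ᵀ)ᵀ * (Rot θ * M * (Rot θ)ᵀ) =
      Rot θ * (M * Mᵀ - Mᵀ * M) * (Rot θ)ᵀ := by
  have cancel (N : Matrix (Fin 2) (Fin 2) ℝ) : (Rot θ)ᵀ * (Rot θ * N) = N := by
    rw [← Matrix.mul_assoc, transpose_Rot_mul_Rot, Matrix.one_mul]
  simp only [transpose_mul, transpose_transpose, Matrix.mul_assoc, cancel, Matrix.mul_sub,
    Matrix.sub_mul]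

/-- The asymptotic trajectory of two merging `0`-jetlets is an exact solution of the
single `1`-jetlet evolution equation `μ̇ = μ·ξᵀ - ξᵀ·μ`. -/
theorem mergedState_solves_one_jetlet_equation (ζ p_φ : ℝ) (t : ℝ) :
    HasDerivAt (mergedState ζ p_φ)
      (mergedState ζ p_φ t * (velGrad (mergedState ζ p_φ t))ᵀ -
        (velGrad (mergedState ζ p_φ t))ᵀ * mergedState ζ p_φ t) t := by
  rw [commutator_velGrad, mergedState, commutator_transpose_conj_Rot]
  have hθ : HasDerivAt (fun u : ℝ => 3 / 4 * p_φ * u) (3 / 4 * p_φ) t := by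
    simpa using (hasDerivAt_id t).const_mul (3 / 4 * p_φ)
  have hc := hθ.cos
  have hs := hθ.sin
  have hx := (hc.mul_const ζ).sub (hs.mul_const p_φ)
  have hy := (hs.mul_const ζ).add (hc.mul_const p_φ)
  suffices h : ∀ i j, HasDerivAt (fun u => mergedState ζ p_φ u i j) _ t from
    hasDerivAt_pi.2 fun i => hasDerivAt_pi.2 fun j => h i j
  have entry {f g : ℝ → ℝ} {f' g' : ℝ} (hf : HasDerivAt f f' t) (hfg : ∀ u, g u = f u)
      (hg : g' = f') : HasDerivAt g g' t := by
    rw [funext hfg, hg]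
    exact hf
  rw [Fin.forall_fin_two, Fin.forall_fin_two, Fin.forall_fin_two]
  refine ⟨⟨entry (hx.mul hc) (fun u => ?_) ?_, entry (hx.mul hs) (fun u => ?_) ?_⟩,
    ⟨entry (hy.mul hc) (fun u => ?_) ?_, entry (hy.mul hs) (fun u => ?_) ?_⟩⟩
  all_goals
    simp only [mergedState, Rot, Matrix.smul_apply, Matrix.sub_apply, Matrix.mul_apply,
      Matrix.transpose_apply, Fin.sum_univ_two, Matrix.of_apply, Matrix.cons_val_zero,
      Matrix.cons_val_one, Pi.add_apply, Pi.sub_apply, Pi.mul_apply, smul_eq_mul]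
    ring
end

section
/- Let E > 0 and let g(ρ) = 1 − (1−e^{−ρ})/ρ for ρ > 0. Suppose r, p_r : ℝ → ℝ are such that r(t) > 0 for all t ≥ 0, r is differentiable with r′(t) = p_r(t)·g(r(t)²/2) (the radial Hamilton equation ṙ = ∂H/∂p_r), and the energy is conserved: p_r(t)²·g(r(t)²/2) = 2E for all t ≥ 0. Then r(t) ≥ r(0)·e^{−√(E/2)·t} for all t ≥ 0. In particular, the inter-particle distance cannot reach zero in finite time: two head-on colliding 0-jetlets merge only in infinite time, with relative velocity decaying (at worst) exponentially. -/
/-- The quadratic Taylor upper bound for `e^{-x}`, `x ≥ 0`. -/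
theorem exp_neg_le_quadratic {x : ℝ} (hx : 0 ≤ x) : Real.exp (-x) ≤ 1 - x + x ^ 2 / 2 := by
  have hq := Real.quadratic_le_exp_of_nonneg hx
  have hpos : 0 ≤ 1 - x + x ^ 2 / 2 := by nlinarith [sq_nonneg (x - 1)]
  rw [Real.exp_neg, inv_le_iff_one_le_mul₀ (Real.exp_pos x)]
  nlinarith [mul_le_mul_of_nonneg_left hq hpos, sq_nonneg (x ^ 2)]

theorem one_sub_one_sub_exp_neg_div_le {x : ℝ} (hx : 0 < x) :
    1 - (1 - Real.exp (-x)) / x ≤ x / 2 := by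
  have h : 1 - x / 2 ≤ (1 - Real.exp (-x)) / x := by
    rw [le_div_iff₀ hx]
    nlinarith [exp_neg_le_quadratic hx.le]
  linarith

/-- A function with `f' ≥ -c f` on `[0, ∞)` decays at most exponentially with rate `c`. -/
theorem mul_exp_neg_le_of_hasDerivAt {f f' : ℝ → ℝ} {c : ℝ}
    (hf : ∀ t, 0 ≤ t → HasDerivAt f (f' t) t) (hf' : ∀ t, 0 ≤ t → -(c * f t) ≤ f' t)
    {t : ℝ} (ht : 0 ≤ t) : f 0 * Real.exp (-c * t) ≤ f t := by
  have hd : ∀ s, 0 ≤ s → HasDerivAt (fun u => f u * Real.exp (c * u))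
      (f' s * Real.exp (c * s) + f s * (Real.exp (c * s) * c)) s := fun s hs =>
    (hf s hs).mul (by simpa using ((hasDerivAt_id s).const_mul c).exp)
  have hmono : MonotoneOn (fun u => f u * Real.exp (c * u)) (Set.Ici 0) := by
    apply monotoneOn_of_deriv_nonneg (convex_Ici 0)
    · exact fun s hs => (hd s hs).continuousAt.continuousWithinAt
    · exact fun s hs => (hd s (interior_subset hs)).differentiableAt.differentiableWithinAt
    · intro s hs
      have hs0 : 0 ≤ s := interior_subset hs
      rw [(hd s hs0).deriv]
      have hnonneg : 0 ≤ (f' s + c * f s) * Real.exp (c * s) :=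
        mul_nonneg (by linarith [hf' s hs0]) (Real.exp_pos _).le
      linarith
  have h := hmono Set.self_mem_Ici (Set.mem_Ici.2 ht) ht
  simp only [mul_zero, Real.exp_zero, mul_one] at h
  rwa [neg_mul, Real.exp_neg, ← div_eq_mul_inv, div_le_iff₀ (Real.exp_pos _)]


/-- Two head-on colliding `0`-jetlets merge only in infinite time: if `r(t) > 0`,
`ṙ = p_r·g(r²/2)` with `g(ρ) = 1 - (1-e^{-ρ})/ρ`, and the energy
`p_r²·g(r²/2) = 2E` is conserved, then `r(t) ≥ r(0)·e^{-√(E/2)·t}` for all `t ≥ 0`,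
so the inter-particle distance cannot reach zero in finite time. -/
theorem zero_jetlet_merge_infinite_time
    (E : ℝ) (hE : 0 < E) (r p_r : ℝ → ℝ)
    (hrpos : ∀ t : ℝ, 0 ≤ t → 0 < r t)
    (hode : ∀ t : ℝ, 0 ≤ t →
      HasDerivAt r (p_r t * (1 - (1 - Real.exp (-(r t ^ 2 / 2))) / (r t ^ 2 / 2))) t)
    (henergy : ∀ t : ℝ, 0 ≤ t →
      p_r t ^ 2 * (1 - (1 - Real.exp (-(r t ^ 2 / 2))) / (r t ^ 2 / 2)) = 2 * E) :
    ∀ t : ℝ, 0 ≤ t → r 0 * Real.exp (-Real.sqrt (E / 2) * t) ≤ r t := by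
  intro t ht
  refine mul_exp_neg_le_of_hasDerivAt hode (fun s hs => ?_) ht
  have hr := hrpos s hs
  have hg := one_sub_one_sub_exp_neg_div_le (x := r s ^ 2 / 2) (by positivity)
  have he := henergy s hs
  set g := 1 - (1 - Real.exp (-(r s ^ 2 / 2))) / (r s ^ 2 / 2)
  refine (abs_le_of_sq_le_sq' ?_ (by positivity)).1
  calc (p_r s * g) ^ 2 = 2 * E * g := by rw [← he]; ring
    _ ≤ 2 * E * (r s ^ 2 / 2 / 2) := by gcongr
    _ = (Real.sqrt (E / 2) * r s) ^ 2 := by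
      rw [mul_pow, Real.sq_sqrt (by positivity)]; ring
end

section
/- Let n ≥ 1, let C ≥ 0, and let u : ℝⁿ → ℝⁿ be twice continuously differentiable with ‖D²u(x)‖ ≤ C for all x (the norm of the second Fréchet derivative). For q̄, q̃, p₁, p₂ ∈ ℝⁿ set q₁ = q̄ − q̃/2, q₂ = q̄ + q̃/2, p̄ = p₁ + p₂, p̃ = (1/2)(p₂ − p₁). Then | ⟨p₁, u(q₁)⟩ + ⟨p₂, u(q₂)⟩ − ⟨p̄, u(q̄)⟩ − ⟨p̃, Du(q̄)·q̃⟩ | ≤ (C/8)·(‖p₁‖ + ‖p₂‖)·‖q̃‖². That is, the momentum distribution p₁⊗δ_{q₁} + p₂⊗δ_{q₂} of two nearby 0-jetlets agrees with the first-order jetlet distribution p̄⊗δ_{q̄} + p̃⊗(−q̃ʲ∂ⱼδ_{q̄}) up to an error of order (|p₁|+|p₂|)·|q̃|² when tested against u. -/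
open scoped RealInnerProductSpace

/-- First-order Taylor expansion with a uniform bound on the second derivative. -/
theorem norm_sub_sub_fderiv_le_of_norm_iteratedFDeriv_two_le
    {E F : Type*} [NormedAddCommGroup E] [NormedSpace ℝ E]
    [NormedAddCommGroup F] [NormedSpace ℝ F] {C : ℝ} {f : E → F}
    (hf : ContDiff ℝ 2 f) (hbound : ∀ x, ‖iteratedFDeriv ℝ 2 f x‖ ≤ C) (x v : E) :
    ‖f (x + v) - f x - fderiv ℝ f x v‖ ≤ C / 2 * ‖v‖ ^ 2 := by
  have hdf : Differentiable ℝ f := hf.differentiable (by norm_num)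
  have hd2f : Differentiable ℝ (fderiv ℝ f) :=
    (hf.fderiv_right (m := 1) (by norm_num)).differentiable (by norm_num)
  have hlip (y : E) : ‖fderiv ℝ f y - fderiv ℝ f x‖ ≤ C * ‖y - x‖ := by
    refine convex_univ.norm_image_sub_le_of_norm_fderiv_le (𝕜 := ℝ)
      (fun z _ => hd2f z) (fun z _ => ?_) (Set.mem_univ x) (Set.mem_univ y)
    rw [← norm_iteratedFDeriv_one, norm_iteratedFDeriv_fderiv]
    exact hbound z
  have hderiv (t : ℝ) : HasDerivAt (fun s : ℝ => f (x + s • v) - f x - s • fderiv ℝ f x v)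
      (fderiv ℝ f (x + t • v) v - fderiv ℝ f x v) t := by
    have hline : HasDerivAt (fun s : ℝ => x + s • v) v t := by
      simpa using ((hasDerivAt_id t).smul_const v).const_add x
    have hlin : HasDerivAt (fun s : ℝ => s • fderiv ℝ f x v) (fderiv ℝ f x v) t := by
      simpa using (hasDerivAt_id t).smul_const (fderiv ℝ f x v)
    exact (((hdf _).hasFDerivAt.comp_hasDerivAt t hline).sub_const (f x)).sub hlin
  have hB (t : ℝ) : HasDerivAt (fun s : ℝ => C / 2 * ‖v‖ ^ 2 * s ^ 2) (C * ‖v‖ ^ 2 * t) t := by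
    refine ((hasDerivAt_pow 2 t).const_mul (C / 2 * ‖v‖ ^ 2)).congr_deriv ?_
    push_cast
    ring
  have h := image_norm_le_of_norm_deriv_right_le_deriv_boundary (a := 0) (b := 1)
    (fun t _ => (hderiv t).continuousAt.continuousWithinAt)
    (fun t _ => (hderiv t).hasDerivWithinAt) (by simp) hB
    (fun t ht => ?_) (Set.right_mem_Icc.2 zero_le_one)
  · simpa using h
  · rw [← sub_apply]
    calc ‖(fderiv ℝ f (x + t • v) - fderiv ℝ f x) v‖
        ≤ ‖fderiv ℝ f (x + t • v) - fderiv ℝ f x‖ * ‖v‖ := ContinuousLinearMap.le_opNorm _ _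
      _ ≤ C * ‖x + t • v - x‖ * ‖v‖ := by gcongr; exact hlip _
      _ = C * ‖v‖ ^ 2 * t := by
        rw [add_sub_cancel_left, norm_smul, Real.norm_of_nonneg ht.1]
        ring

/-- The momentum distribution `p₁⊗δ_{q₁} + p₂⊗δ_{q₂}` of two nearby `0`-jetlets agrees
with the first-order jetlet distribution `p̄⊗δ_{q̄} + p̃⊗(-q̃ʲ∂ⱼδ_{q̄})` up to an error of
order `(‖p₁‖+‖p₂‖)·‖q̃‖²` when tested against a vector field `u` with bounded second
derivative. -/
theorem zero_jetlet_pair_approximates_one_jetlet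
    (n : ℕ) (hn : 1 ≤ n) (C : ℝ) (hC : 0 ≤ C)
    (u : EuclideanSpace ℝ (Fin n) → EuclideanSpace ℝ (Fin n))
    (hu : ContDiff ℝ 2 u)
    (hbound : ∀ x, ‖iteratedFDeriv ℝ 2 u x‖ ≤ C)
    (qbar qtil p₁ p₂ : EuclideanSpace ℝ (Fin n)) :
    |⟪p₁, u (qbar - (1 / 2 : ℝ) • qtil)⟫ + ⟪p₂, u (qbar + (1 / 2 : ℝ) • qtil)⟫ -
        ⟪p₁ + p₂, u qbar⟫ - ⟪(1 / 2 : ℝ) • (p₂ - p₁), fderiv ℝ u qbar qtil⟫| ≤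
      C / 8 * (‖p₁‖ + ‖p₂‖) * ‖qtil‖ ^ 2 := by
  have hrem (w : EuclideanSpace ℝ (Fin n)) (hw : ‖w‖ = 1 / 2 * ‖qtil‖)
      (p : EuclideanSpace ℝ (Fin n)) :
      |⟪p, u (qbar + w) - u qbar - fderiv ℝ u qbar w⟫| ≤ ‖p‖ * (C / 8 * ‖qtil‖ ^ 2) := by
    refine (abs_real_inner_le_norm _ _).trans (mul_le_mul_of_nonneg_left ?_ (norm_nonneg p))
    refine (norm_sub_sub_fderiv_le_of_norm_iteratedFDeriv_two_le hu hbound qbar w).trans_eq ?_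
    rw [hw]
    ring
  have hhalf : ‖(1 / 2 : ℝ) • qtil‖ = 1 / 2 * ‖qtil‖ := by
    rw [norm_smul, Real.norm_of_nonneg (by norm_num)]
  have h₁ := hrem (-((1 / 2 : ℝ) • qtil)) (by rw [norm_neg, hhalf]) p₁
  have h₂ := hrem ((1 / 2 : ℝ) • qtil) hhalf p₂
  rw [← sub_eq_add_neg] at h₁
  calc _ = |⟪p₁, u (qbar - (1 / 2 : ℝ) • qtil) - u qbar -
          fderiv ℝ u qbar (-((1 / 2 : ℝ) • qtil))⟫ +
        ⟪p₂, u (qbar + (1 / 2 : ℝ) • qtil) - u qbar -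
          fderiv ℝ u qbar ((1 / 2 : ℝ) • qtil)⟫| := by
        congr 1
        simp only [map_neg, map_smul, inner_sub_right, inner_neg_right, inner_add_left,
          inner_sub_left, real_inner_smul_left, real_inner_smul_right]
        ring
    _ ≤ ‖p₁‖ * (C / 8 * ‖qtil‖ ^ 2) + ‖p₂‖ * (C / 8 * ‖qtil‖ ^ 2) :=
        (abs_add_le _ _).trans (add_le_add h₁ h₂)
    _ = C / 8 * (‖p₁‖ + ‖p₂‖) * ‖qtil‖ ^ 2 := by ring
end
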